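/- arXiv:1903.04331 — 2 statements merged into one kernel-verified Lean document; each statement's English description precedes it below -/
import Mathlib

section
/- For every integer l ≥ 0 and every α ∈ [0, 1] there exists a constant C > 0 (depending only on l and α) such that: for every n ≥ 1, every σ = (λ_1, …, λ_n) ∈ D^n with r = max_i |λ_i|, and every z ∈ ℂ with |z| ≤ 1, the l-th derivative of the reproducing kernel k_z^B (B = B_σ) satisfies the weighted Bloch estimate sup_{w∈D} |(k_z^B)^{(l+1)}(w)| · (1 − |w|)^α ≤ C · (n/(1−r))^{l+2−α}. (Proposition 4.1, part (2).) -/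
open Complex Metric

noncomputable section

/-- The elementary Blaschke factor `b_λ(z) = (λ - z)/(1 - conj(λ) z)`. -/
def blaschkeF (l z : ℂ) : ℂ := (l - z) / (1 - (starRingEnd ℂ) l * z)

/-- The finite Blaschke product `B_σ = ∏ b_{λ_i}`. -/
def blaschkeProd {n : ℕ} (σ : Fin n → ℂ) (z : ℂ) : ℂ := ∏ i, blaschkeF (σ i) z

/-- The reproducing kernel of the model space `K_{B_σ}`:
`k_z^B(w) = (1 - conj(B(z)) B(w))/(1 - conj(z) w)`. -/
def modelKernel {n : ℕ} (σ : Fin n → ℂ) (z w : ℂ) : ℂ :=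
  (1 - (starRingEnd ℂ) (blaschkeProd σ z) * blaschkeProd σ w) /
    (1 - (starRingEnd ℂ) z * w)

open scoped ComplexConjugate

theorem sq_norm_sub_eq_sq_norm_one_sub_conj_mul (a w : ℂ) :
    ‖a - w‖ ^ 2 = ‖1 - conj a * w‖ ^ 2 + (‖w‖ ^ 2 - 1) * (1 - ‖a‖ ^ 2) := by
  simp only [Complex.sq_norm, Complex.normSq_apply, Complex.sub_re, Complex.sub_im,
    Complex.mul_re, Complex.mul_im, Complex.conj_re, Complex.conj_im, Complex.one_re,
    Complex.one_im]
  ring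

theorem one_sub_mul_le_norm_one_sub_conj_mul (a w : ℂ) :
    1 - ‖a‖ * ‖w‖ ≤ ‖1 - conj a * w‖ := by
  have h := norm_sub_norm_le (1 : ℂ) (conj a * w)
  rwa [norm_one, norm_mul, RCLike.norm_conj] at h

theorem one_sub_conj_mul_ne_zero {a w : ℂ} (h : ‖a‖ * ‖w‖ < 1) : 1 - conj a * w ≠ 0 :=
  norm_pos_iff.mp ((sub_pos.mpr h).trans_le (one_sub_mul_le_norm_one_sub_conj_mul a w))

theorem differentiableAt_blaschkeF {a w : ℂ} (h : ‖a‖ * ‖w‖ < 1) :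
    DifferentiableAt ℂ (blaschkeF a) w := by
  have := one_sub_conj_mul_ne_zero h
  unfold blaschkeF
  fun_prop (disch := assumption)

theorem norm_blaschkeF_le_one {a w : ℂ} (ha : ‖a‖ < 1) (hw : ‖w‖ ≤ 1) :
    ‖blaschkeF a w‖ ≤ 1 := by
  rw [blaschkeF, norm_div]
  refine div_le_one_of_le₀ ((sq_le_sq₀ (norm_nonneg _) (norm_nonneg _)).mp ?_) (norm_nonneg _)
  rw [sq_norm_sub_eq_sq_norm_one_sub_conj_mul]
  have h1 : ‖w‖ ^ 2 ≤ 1 := pow_le_one₀ (norm_nonneg _) hw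
  have h2 : ‖a‖ ^ 2 ≤ 1 := pow_le_one₀ (norm_nonneg _) ha.le
  nlinarith

/-- The growth of a Blaschke factor slightly outside the unit disc. -/
theorem norm_blaschkeF_le_of_norm_le {a w : ℂ} {t : ℝ} (ht : 0 ≤ t) (ht1 : t ≤ 1 / 2)
    (ha : ‖a‖ < 1) (hw : ‖w‖ ≤ 1 + t * (1 - ‖a‖)) :
    ‖blaschkeF a w‖ ≤ 1 + 24 * t := by
  have ha0 := norm_nonneg a
  have hw0 := norm_nonneg w
  have hlow : (1 - ‖a‖) / 2 ≤ ‖1 - conj a * w‖ := by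
    refine le_trans ?_ (one_sub_mul_le_norm_one_sub_conj_mul a w)
    nlinarith [mul_le_mul_of_nonneg_left hw ha0, mul_nonneg ha0 (sub_nonneg.mpr ha.le),
      mul_nonneg ht (sub_nonneg.mpr ha.le)]
  have hpos : 0 < ‖1 - conj a * w‖ := by linarith
  have hw2 : ‖w‖ ^ 2 - 1 ≤ 3 * (t * (1 - ‖a‖)) := by
    have hs := mul_nonneg ht (sub_nonneg.mpr ha.le)
    have hs1 : t * (1 - ‖a‖) ≤ 1 := by nlinarith
    have := pow_le_pow_left₀ hw0 hw 2
    nlinarith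
  have hsq : 3 * (t * (1 - ‖a‖)) * (1 - ‖a‖ ^ 2) ≤ 24 * t * ‖1 - conj a * w‖ ^ 2 := by
    have h1 : ((1 - ‖a‖) / 2) ^ 2 ≤ ‖1 - conj a * w‖ ^ 2 := by gcongr
    have h2 : 3 * (1 - ‖a‖) * (1 - ‖a‖ ^ 2) ≤ 24 * ((1 - ‖a‖) / 2) ^ 2 := by
      nlinarith [sq_nonneg (1 - ‖a‖), mul_nonneg (sq_nonneg (1 - ‖a‖)) (sub_nonneg.mpr ha.le)]
    nlinarith
  rw [blaschkeF, norm_div, div_le_iff₀ hpos]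
  refine (sq_le_sq₀ (norm_nonneg _) (by positivity)).mp ?_
  rw [sq_norm_sub_eq_sq_norm_one_sub_conj_mul]
  have h3 : 0 ≤ 1 - ‖a‖ ^ 2 := by nlinarith
  have h4 := mul_le_mul_of_nonneg_right hw2 h3
  nlinarith [mul_nonneg ht (sq_nonneg ‖1 - conj a * w‖),
    mul_nonneg (sq_nonneg t) (sq_nonneg ‖1 - conj a * w‖)]

theorem one_sub_conj_blaschkeF_mul {a z w : ℂ} (hz : 1 - conj a * z ≠ 0)
    (hw : 1 - conj a * w ≠ 0) :
    1 - conj (blaschkeF a z) * blaschkeF a w =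
      (1 - conj z * w) * ((1 - conj a * a) / ((1 - a * conj z) * (1 - conj a * w))) := by
  have hz' : 1 - conj z * a ≠ 0 := by
    intro h
    apply hz
    rw [← Complex.conj_conj (1 - conj a * z)]
    simp [mul_comm a, h]
  simp only [blaschkeF, map_div₀, map_sub, map_mul, map_one, Complex.conj_conj, mul_comm a]
  field_simp
  ring

/-- The telescoping (Malmquist–Walsh) expansion exhibits the model kernel as the restriction of a
function that is holomorphic and bounded on a disc larger than the unit disc. -/
theorem exists_extension_of_modelKernel {ι : Type*} (σ : ι → ℂ) {z : ℂ} (hz : ‖z‖ ≤ 1)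
    {r R q : ℝ} (hσ : ∀ i, ‖σ i‖ ≤ r) (hr : r < 1) (hR : r * R ≤ (1 + r) / 2) (hq : 1 ≤ q)
    (hb : ∀ i w, ‖w‖ ≤ R → ‖blaschkeF (σ i) w‖ ≤ q) (s : Finset ι) :
    ∃ g : ℂ → ℂ, ∀ w, ‖w‖ ≤ R → DifferentiableAt ℂ g w ∧
      1 - conj (∏ i ∈ s, blaschkeF (σ i) z) * ∏ i ∈ s, blaschkeF (σ i) w =
        (1 - conj z * w) * g w ∧
      ‖g w‖ ≤ s.card * (4 / (1 - r) * q ^ s.card) := by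
  classical
  have hlow (i : ι) {w : ℂ} (hw : ‖w‖ ≤ R) : (1 - r) / 2 ≤ 1 - ‖σ i‖ * ‖w‖ := by
    have := mul_le_mul (hσ i) hw (norm_nonneg w) ((norm_nonneg _).trans (hσ i))
    linarith
  induction s using Finset.induction_on with
  | empty => exact ⟨0, fun w _ ↦ by simp⟩
  | insert a s ha ih =>
    obtain ⟨g, hg⟩ := ih
    have ha1 : ‖σ a‖ < 1 := (hσ a).trans_lt hr
    have hza : ‖σ a‖ * ‖z‖ < 1 :=
      (mul_le_of_le_one_right (norm_nonneg _) hz).trans_lt ha1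
    have hz1 : ‖1 - σ a * conj z‖ = ‖1 - conj (σ a) * z‖ := by
      rw [← RCLike.norm_conj]
      simp
    have hzlow : 1 - ‖σ a‖ ≤ ‖1 - σ a * conj z‖ := by
      rw [hz1]
      refine le_trans ?_ (one_sub_mul_le_norm_one_sub_conj_mul _ _)
      linarith [mul_le_of_le_one_right (norm_nonneg (σ a)) hz]
    refine ⟨fun w ↦ g w + (conj (∏ i ∈ s, blaschkeF (σ i) z) * ∏ i ∈ s, blaschkeF (σ i) w) *
      ((1 - conj (σ a) * σ a) / ((1 - σ a * conj z) * (1 - conj (σ a) * w))), fun w hw ↦ ?_⟩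
    obtain ⟨hd, he, hn⟩ := hg w hw
    have hwlt (i : ι) : ‖σ i‖ * ‖w‖ < 1 := by linarith [hlow i hw]
    have hwa := one_sub_conj_mul_ne_zero (hwlt a)
    have hz0 : 1 - σ a * conj z ≠ 0 := norm_pos_iff.mp (by linarith)
    refine ⟨?_, ?_, ?_⟩
    · have hprod : DifferentiableAt ℂ (fun w ↦ ∏ i ∈ s, blaschkeF (σ i) w) w :=
        DifferentiableAt.fun_finsetProd fun i _ ↦ differentiableAt_blaschkeF (hwlt i)
      have hden := mul_ne_zero hz0 hwa
      fun_prop (disch := assumption)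
    · have hf := one_sub_conj_blaschkeF_mul (one_sub_conj_mul_ne_zero hza) hwa
      rw [Finset.prod_insert ha, Finset.prod_insert ha, map_mul, mul_add, ← he]
      linear_combination (conj (∏ i ∈ s, blaschkeF (σ i) z) * ∏ i ∈ s, blaschkeF (σ i) w) * hf
    · have hBz : ‖conj (∏ i ∈ s, blaschkeF (σ i) z)‖ ≤ 1 := by
        rw [RCLike.norm_conj, norm_prod]
        exact Finset.prod_le_one (fun _ _ ↦ norm_nonneg _)
          fun i _ ↦ norm_blaschkeF_le_one ((hσ i).trans_lt hr) hz
      have hBw : ‖∏ i ∈ s, blaschkeF (σ i) w‖ ≤ q ^ s.card := by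
        rw [norm_prod]
        exact (Finset.prod_le_prod (fun _ _ ↦ norm_nonneg _) fun i _ ↦ hb i w hw).trans_eq
          (Finset.prod_const q)
      have hterm : ‖(1 - conj (σ a) * σ a) / ((1 - σ a * conj z) * (1 - conj (σ a) * w))‖
          ≤ 4 / (1 - r) := by
        have hnum : ‖1 - conj (σ a) * σ a‖ ≤ 2 * (1 - ‖σ a‖) := by
          rw [mul_comm, Complex.mul_conj, Complex.normSq_eq_norm_sq, ← Complex.ofReal_one,
            ← Complex.ofReal_sub, Complex.norm_real, Real.norm_eq_abs, abs_of_nonneg]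
          · nlinarith [norm_nonneg (σ a)]
          · nlinarith [norm_nonneg (σ a)]
        have hw2 := (hlow a hw).trans (one_sub_mul_le_norm_one_sub_conj_mul (σ a) w)
        have h1 : 0 < 1 - r := by linarith
        have h2 : 0 < 1 - ‖σ a‖ := by linarith
        rw [norm_div, norm_mul]
        calc _ ≤ 2 * (1 - ‖σ a‖) / ((1 - ‖σ a‖) * ((1 - r) / 2)) := by gcongr
          _ = 4 / (1 - r) := by field_simp; norm_num
      have hK : 0 ≤ 4 / (1 - r) := by
        have : 0 < 1 - r := by linarith
        positivity
      have hqs : q ^ s.card ≤ q ^ (s.card + 1) := pow_le_pow_right₀ hq s.card.le_succ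
      rw [Finset.card_insert_of_notMem ha]
      calc _ ≤ s.card * (4 / (1 - r) * q ^ s.card) + 1 * q ^ s.card * (4 / (1 - r)) := by
            refine (norm_add_le _ _).trans (add_le_add hn ?_)
            rw [norm_mul, norm_mul]
            gcongr
        _ = (s.card + 1 : ℕ) * (4 / (1 - r) * q ^ s.card) := by push_cast; ring
        _ ≤ _ := by gcongr

/-- Interpolation between the bounds `A * N` and `A / d`. -/
theorem mul_rpow_le_of_le_mul_of_le_div {X A N d α : ℝ} (hA : 0 ≤ A) (hN : 0 < N)
    (hd : 0 < d) (hα0 : 0 ≤ α) (hα1 : α ≤ 1) (h1 : X ≤ A * N) (h2 : N⁻¹ ≤ d → X ≤ A / d) :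
    X * d ^ α ≤ A * N ^ (1 - α) := by
  rcases le_total N⁻¹ d with h | h
  · calc X * d ^ α ≤ A / d * d ^ α := by gcongr; exact h2 h
      _ = A * (d⁻¹) ^ (1 - α) := by
        rw [Real.inv_rpow hd.le, ← Real.rpow_neg hd.le, neg_sub, Real.rpow_sub hd,
          Real.rpow_one]
        ring
      _ ≤ A * N ^ (1 - α) := by
        have : d⁻¹ ≤ N := inv_le_of_inv_le₀ hN h
        have : 0 ≤ 1 - α := by linarith
        gcongr
  · calc X * d ^ α ≤ A * N * (N⁻¹) ^ α := by gcongr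
      _ = A * N ^ (1 - α) := by
        rw [Real.inv_rpow hN.le, Real.rpow_sub hN, Real.rpow_one]
        ring

theorem norm_modelKernel_le {n : ℕ} {σ : Fin n → ℂ} (hσ : ∀ i, ‖σ i‖ < 1) {z w : ℂ}
    (hz : ‖z‖ ≤ 1) (hw : ‖w‖ < 1) : ‖modelKernel σ z w‖ ≤ 2 / (1 - ‖w‖) := by
  have hB {v : ℂ} (hv : ‖v‖ ≤ 1) : ‖blaschkeProd σ v‖ ≤ 1 := by
    rw [blaschkeProd, norm_prod]
    exact Finset.prod_le_one (fun _ _ ↦ norm_nonneg _) fun i _ ↦ norm_blaschkeF_le_one (hσ i) hv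
  have hlow : 1 - ‖w‖ ≤ ‖1 - conj z * w‖ := by
    refine le_trans ?_ (one_sub_mul_le_norm_one_sub_conj_mul z w)
    linarith [mul_le_of_le_one_left (norm_nonneg w) hz]
  have hpos : 0 < 1 - ‖w‖ := by linarith
  rw [modelKernel, norm_div]
  gcongr
  refine (norm_sub_le _ _).trans ?_
  rw [norm_one, norm_mul, RCLike.norm_conj]
  linarith [mul_le_one₀ (hB hz) (norm_nonneg _) (hB hw.le)]

/-- Proposition 4.1, part (2): for every integer `l ≥ 0` and `α ∈ [0,1]`,
`‖(k_z^B)^{(l)}‖_{B_α} ≤ C (n/(1-r))^{l+2-α}`, i.e.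
`sup_{w ∈ D} |(k_z^B)^{(l+1)}(w)| (1-|w|)^α ≤ C (n/(1-r))^{l+2-α}`,
where `r = max_i |λ_i|` and `|z| ≤ 1`. -/
theorem kernel_Bloch_norm_estimate (l : ℕ) (α : ℝ) (hα0 : 0 ≤ α) (hα1 : α ≤ 1) :
    ∃ C : ℝ, 0 < C ∧
      ∀ (n : ℕ), 1 ≤ n → ∀ σ : Fin n → ℂ,
      ∀ r : ℝ, (∀ i, ‖σ i‖ ≤ r) → r < 1 →
      ∀ z : ℂ, ‖z‖ ≤ 1 →
      ∀ w ∈ ball (0:ℂ) 1,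
        ‖iteratedDeriv (l + 1) (modelKernel σ z) w‖ * (1 - ‖w‖) ^ α
          ≤ C * ((n : ℝ) / (1 - r)) ^ ((l : ℝ) + 2 - α) := by
  have hC : (0 : ℝ) < (l + 1).factorial * 2 ^ (l + 1) * (4 * Real.exp 12) := by positivity
  refine ⟨_, hC, fun n hn σ r hσ hr z hz w hw ↦ ?_⟩
  rw [mem_ball_zero_iff] at hw
  have hn1 : (1 : ℝ) ≤ n := by exact_mod_cast hn
  have hr0 : 0 ≤ r := (norm_nonneg _).trans (hσ ⟨0, hn⟩)
  have hr1 : 0 < 1 - r := by linarith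
  set N : ℝ := n / (1 - r) with hN
  have hN0 : 0 < N := by positivity
  set δ : ℝ := 1 / (2 * n) * (1 - r) with hδ
  have hδ0 : 0 < δ := by positivity
  have hδN : δ = 1 / (2 * N) := by rw [hδ, hN]; field_simp
  have ht : 1 / (2 * (n : ℝ)) ≤ 1 / 2 := by
    gcongr
    linarith
  have hb (i : Fin n) (v : ℂ) (hv : ‖v‖ ≤ 1 + δ) : ‖blaschkeF (σ i) v‖ ≤ 1 + 12 / n := by
    have h := norm_blaschkeF_le_of_norm_le (a := σ i) (w := v) (t := 1 / (2 * n)) (by positivity)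
      ht ((hσ i).trans_lt hr) (hv.trans (by rw [hδ]; gcongr; exact hσ i))
    refine h.trans_eq ?_
    ring
  have hR : r * (1 + δ) ≤ (1 + r) / 2 := by
    have : δ ≤ 1 / 2 * (1 - r) := by rw [hδ]; gcongr
    nlinarith
  obtain ⟨g, hg⟩ := exists_extension_of_modelKernel σ hz hσ hr hR
    (le_add_of_nonneg_right (by positivity)) hb Finset.univ
  have hexp : (1 + 12 / (n : ℝ)) ^ n ≤ Real.exp 12 := by
    calc (1 + 12 / (n : ℝ)) ^ n ≤ Real.exp (12 / n) ^ n := by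
          gcongr
          linarith [Real.add_one_le_exp (12 / (n : ℝ))]
      _ = Real.exp 12 := by
          rw [← Real.exp_nat_mul]
          congr 1
          field_simp
  have hgN {v : ℂ} (hv : ‖v‖ ≤ 1 + δ) : ‖g v‖ ≤ 4 * Real.exp 12 * N := by
    refine (hg v hv).2.2.trans ?_
    rw [Finset.card_univ, Fintype.card_fin]
    calc (n : ℝ) * (4 / (1 - r) * (1 + 12 / n) ^ n) ≤ n * (4 / (1 - r) * Real.exp 12) := by gcongr
      _ = _ := by rw [hN]; ring
  have hkg {v : ℂ} (hv : ‖v‖ < 1) : modelKernel σ z v = g v := by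
    have hne : 1 - conj z * v ≠ 0 := one_sub_conj_mul_ne_zero
      ((mul_le_of_le_one_left (norm_nonneg v) hz).trans_lt hv)
    rw [modelKernel, blaschkeProd, blaschkeProd, (hg v (by linarith)).2.1,
      mul_div_cancel_left₀ _ hne]
  have hder : iteratedDeriv (l + 1) (modelKernel σ z) w = iteratedDeriv (l + 1) g w := by
    apply Filter.EventuallyEq.iteratedDeriv_eq
    filter_upwards [isOpen_ball.mem_nhds (mem_ball_zero_iff.mpr hw)] with v hv
    exact hkg (mem_ball_zero_iff.mp hv)
  have hnear {v : ℂ} (hv : v ∈ closedBall w δ) : ‖v‖ ≤ ‖w‖ + δ := by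
    have := norm_le_norm_add_norm_sub' v w
    rw [mem_closedBall, dist_eq_norm] at hv
    linarith
  have hcont : DiffContOnCl ℂ g (ball w δ) := by
    refine DifferentiableOn.diffContOnCl fun v hv ↦ ?_
    exact (hg v ((hnear (closure_ball_subset_closedBall hv)).trans
      (by linarith))).1.differentiableWithinAt
  have hcauchy {M : ℝ} (hM : ∀ v ∈ sphere w δ, ‖g v‖ ≤ M) :
      ‖iteratedDeriv (l + 1) g w‖ ≤ (l + 1).factorial * 2 ^ (l + 1) * N ^ (l + 1) * M := by
    refine (norm_iteratedDeriv_le_of_forall_mem_sphere_norm_le (l + 1) hδ0 hcont hM).trans_eq ?_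
    rw [hδN, div_pow, mul_pow, one_pow]
    field_simp
  rw [hder]
  have hmain := mul_rpow_le_of_le_mul_of_le_div (α := α) (N := N)
    (A := (l + 1).factorial * 2 ^ (l + 1) * (4 * Real.exp 12) * N ^ (l + 1))
    (by positivity) hN0 (sub_pos.mpr hw) hα0 hα1
    ((hcauchy fun v hv ↦ hgN ((hnear (sphere_subset_closedBall hv)).trans
      (by linarith))).trans_eq (by ring)) ?_
  · refine hmain.trans_eq ?_
    rw [mul_assoc, ← Real.rpow_natCast N (l + 1), ← Real.rpow_add hN0]
    congr 2
    push_cast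
    ring
  · intro hd
    have h2δ : 2 * δ = N⁻¹ := by rw [hδN]; field_simp
    have hd0 : 0 < 1 - ‖w‖ := by linarith
    refine (hcauchy (M := 4 * Real.exp 12 / (1 - ‖w‖)) fun v hv ↦ ?_).trans_eq (by ring)
    have hv' := hnear (sphere_subset_closedBall hv)
    have hv1 : ‖v‖ < 1 := by linarith
    rw [← hkg hv1]
    calc _ ≤ 2 / (1 - ‖v‖) := norm_modelKernel_le (fun i ↦ (hσ i).trans_lt hr) hz hv1
      _ ≤ 2 / ((1 - ‖w‖) / 2) := by gcongr; linarith
      _ = 4 * 1 / (1 - ‖w‖) := by field_simp; norm_num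
      _ ≤ _ := by gcongr; exact Real.one_le_exp (by norm_num)
end
end

section
/- Let l ≥ 0 be an integer, β ∈ (l−1, l], p ∈ [1, ∞), and set N = l+2. There exists a constant C > 0 (depending only on p and β) such that for every r ∈ [0, 1) and every n ≥ 1, the function Q_n(z) = ((1−r^2)/(1+rz)^2) · (Σ_{k=0}^{n−1} b_{−r}(z)^k)^2, where b_{−r}(z) = (−r−z)/(1+rz), satisfies ‖Q_n^N‖_{A^p(β)} ≤ C · n^{2N−(β+2)/p} / (1−r)^{N−(β+2)/p}. (Estimate (6.4) in the proof of the lower bounds.) -/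
open Complex Metric

noncomputable section

/-- The test function
`Q_n(z) = ((1-r^2)/(1+rz)^2) (Σ_{k=0}^{n-1} b_{-r}(z)^k)^2`. -/
def Qfun (n : ℕ) (r : ℝ) (z : ℂ) : ℂ :=
  ((1 - (r : ℂ) ^ 2) / (1 + (r : ℂ) * z) ^ 2) *
    (∑ k ∈ Finset.range n, blaschkeF (-(r : ℂ)) z ^ k) ^ 2

/-- The radial-weighted Bergman norm
`‖f‖_{A^p(β)} = (∫_D |f|^p (1-|z|^2)^β dA)^{1/p}`, `dA` normalized area measure. -/
def bergmanNorm (p β : ℝ) (f : ℂ → ℂ) : ℝ :=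
  (Real.pi⁻¹ * ∫ z in ball (0:ℂ) 1, ‖f z‖ ^ p * (1 - ‖z‖ ^ 2) ^ β) ^ (1 / p)

section

open MeasureTheory Set

lemma rpow_neg_one_add_add_le {a b β q : ℝ} (ha : 0 ≤ a) (hb : 0 ≤ b) (hβ : -1 < β)
    (hq : β + 2 ≤ q) :
    (1 + (a + b)) ^ (-q) ≤ (1 + a) ^ (-(β + 1)) * (1 + b)⁻¹ := by
  calc (1 + (a + b)) ^ (-q) ≤ (1 + (a + b)) ^ (-(β + 1) + -1) :=
        Real.rpow_le_rpow_of_exponent_le (by linarith) (by linarith)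
    _ = (1 + (a + b)) ^ (-(β + 1)) * (1 + (a + b))⁻¹ := by
        rw [Real.rpow_add (by positivity), Real.rpow_neg_one]
    _ ≤ (1 + a) ^ (-(β + 1)) * (1 + b)⁻¹ := by
        gcongr ?_ * ?_
        · exact Real.rpow_le_rpow_of_nonpos (by positivity) (by linarith) (by linarith)
        · gcongr; linarith

lemma sq_add_sq_le_norm_one_sub_polar_sq {s θ : ℝ} (hs0 : 0 ≤ s)
    (hθ : |θ| ≤ Real.pi) :
    (1 - s) ^ 2 + θ ^ 2 ≤ 25 * ‖1 - (s : ℂ) * (Real.cos θ + Real.sin θ * I)‖ ^ 2 := by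
  have hnorm : ‖1 - (s : ℂ) * (Real.cos θ + Real.sin θ * I)‖ ^ 2
      = (1 - s) ^ 2 + 2 * s * (1 - Real.cos θ) := by
    rw [← Complex.normSq_eq_norm_sq, Complex.normSq_apply]
    simp only [sub_re, sub_im, one_re, one_im, re_ofReal_mul, im_ofReal_mul, add_re, add_im,
      ofReal_re, ofReal_im, mul_I_re, mul_I_im]
    linear_combination s ^ 2 * Real.sin_sq_add_cos_sq θ
  have hcos := Real.cos_le_one_sub_mul_cos_sq hθ
  have hpi := Real.pi_pos
  obtain ⟨φ, hφ⟩ : ∃ φ, φ = θ ^ 2 / Real.pi ^ 2 := ⟨_, rfl⟩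
  have hφ0 : 0 ≤ φ := by rw [hφ]; positivity
  have hθφ : θ ^ 2 = φ * Real.pi ^ 2 := by rw [hφ]; field_simp
  have hφ1 : φ ≤ 1 := by
    rw [hφ, div_le_one (by positivity)]
    exact sq_le_sq' (by linarith [abs_le.1 hθ]) (abs_le.1 hθ).2
  have hcos' : 2 * φ ≤ 1 - Real.cos θ := by
    have : 2 / Real.pi ^ 2 * θ ^ 2 = 2 * φ := by rw [hφ]; ring
    linarith
  have hpi2 : Real.pi ^ 2 ≤ 10 := by nlinarith [Real.pi_lt_d2]
  have h1 : 2 * s * (2 * φ) ≤ 2 * s * (1 - Real.cos θ) := by gcongr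
  have h2 : φ * Real.pi ^ 2 ≤ φ * 10 := by gcongr
  rw [hnorm, hθφ]
  nlinarith [mul_nonneg (sub_nonneg.2 hφ1) (sq_nonneg (1 - s)), mul_nonneg hs0 hφ0,
    mul_nonneg hφ0 (sq_nonneg (1 - s)), mul_nonneg hφ0 (sq_nonneg s)]

lemma integrableOn_Ioi_rpow_mul_one_add_sq_rpow {β : ℝ} (hβ : -1 < β) :
    IntegrableOn (fun u : ℝ => u ^ β * (1 + u ^ 2) ^ (-(β + 1))) (Ioi 0) := by
  have hmeas : Measurable (fun u : ℝ => u ^ β * (1 + u ^ 2) ^ (-(β + 1))) := by fun_prop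
  rw [← Ioc_union_Ioi_eq_Ioi zero_le_one]
  refine IntegrableOn.union ?_ ?_
  · have h := (intervalIntegrable_iff_integrableOn_Ioc_of_le zero_le_one).1
      (intervalIntegral.intervalIntegrable_rpow' (a := 0) (b := 1) hβ)
    refine Integrable.mono' h hmeas.aestronglyMeasurable ?_
    refine ae_restrict_of_forall_mem measurableSet_Ioc fun u hu => ?_
    have hu0 : 0 < u := hu.1
    rw [Real.norm_of_nonneg (by positivity)]
    exact mul_le_of_le_one_right (by positivity)
      (Real.rpow_le_one_of_one_le_of_nonpos (by nlinarith) (by linarith))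
  · refine Integrable.mono' (integrableOn_Ioi_rpow_of_lt (a := -β - 2) (by linarith) zero_lt_one)
      hmeas.aestronglyMeasurable ?_
    refine ae_restrict_of_forall_mem measurableSet_Ioi fun u hu => ?_
    have hu0 : 0 < u := zero_lt_one.trans hu
    rw [Real.norm_of_nonneg (by positivity)]
    calc u ^ β * (1 + u ^ 2) ^ (-(β + 1)) ≤ u ^ β * (u ^ 2) ^ (-(β + 1)) := by
          gcongr ?_ * ?_
          exact Real.rpow_le_rpow_of_nonpos (by positivity) (by linarith) (by linarith)
      _ = u ^ (-β - 2) := by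
          rw [← Real.rpow_natCast, ← Real.rpow_mul hu0.le, ← Real.rpow_add hu0]
          congr 1; push_cast; ring

lemma lintegral_Ioi_rpow_mul_one_add_sq_rpow {β k : ℝ} (hβ : -1 < β) (hk : 0 < k) :
    ∫⁻ t in Ioi (0 : ℝ), ENNReal.ofReal (t ^ β * (1 + (k * t) ^ 2) ^ (-(β + 1)))
      = ENNReal.ofReal
        (k ^ (-(β + 1)) * ∫ u in Ioi (0 : ℝ), u ^ β * (1 + u ^ 2) ^ (-(β + 1))) := by
  set g : ℝ → ℝ := fun u => u ^ β * (1 + u ^ 2) ^ (-(β + 1)) with hg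
  have hscale : ∀ t ∈ Ioi (0 : ℝ),
      t ^ β * (1 + (k * t) ^ 2) ^ (-(β + 1)) = k ^ (-β) * g (k * t) := by
    intro t ht
    have hkβ : k ^ (-β) * k ^ β = 1 := by rw [← Real.rpow_add hk]; simp
    simp only [hg]
    rw [Real.mul_rpow hk.le (le_of_lt ht)]
    linear_combination -(t ^ β * (1 + (k * t) ^ 2) ^ (-(β + 1))) * hkβ
  have hintegrable : IntegrableOn (fun t => k ^ (-β) * g (k * t)) (Ioi 0) := by
    refine Integrable.const_mul ?_ _
    have := (integrableOn_Ioi_comp_mul_left_iff g 0 hk).2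
    rw [mul_zero] at this
    exact this (integrableOn_Ioi_rpow_mul_one_add_sq_rpow hβ)
  rw [setLIntegral_congr_fun measurableSet_Ioi
      (fun t ht => congrArg ENNReal.ofReal (hscale t ht)),
    ← ofReal_integral_eq_lintegral_ofReal hintegrable, integral_const_mul,
    integral_comp_mul_left_Ioi g 0 hk, mul_zero, smul_eq_mul, ← mul_assoc]
  · congr 3
    rw [← Real.rpow_neg_one k, ← Real.rpow_add hk]
    congr 1; ring
  · refine ae_restrict_of_forall_mem measurableSet_Ioi fun t ht => ?_
    have ht0 : 0 < t := ht
    simp only [hg, Pi.zero_apply]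
    positivity

lemma lintegral_inv_one_add_sq_mul {k : ℝ} (hk : 0 < k) :
    ∫⁻ θ : ℝ, ENNReal.ofReal (1 + (k * θ) ^ 2)⁻¹ = ENNReal.ofReal (k⁻¹ * Real.pi) := by
  have hintegrable : Integrable fun θ : ℝ => (1 + (k * θ) ^ 2)⁻¹ :=
    integrable_inv_one_add_sq.comp_mul_left' hk.ne'
  rw [← ofReal_integral_eq_lintegral_ofReal hintegrable (.of_forall fun θ => by positivity),
    Measure.integral_comp_mul_left (fun θ : ℝ => (1 + θ ^ 2)⁻¹), integral_univ_inv_one_add_sq,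
    smul_eq_mul, abs_of_pos (inv_pos.2 hk)]

/-- Polar coordinates about the origin, after the reflection `z ↦ -z`. -/
lemma lintegral_neg_polar (f : ℂ → ENNReal) :
    ∫⁻ z, f z = ∫⁻ x in Ioi (0 : ℝ) ×ˢ Ioo (-Real.pi) Real.pi,
      ENNReal.ofReal x.1 * f (-(x.1 * (Real.cos x.2 + Real.sin x.2 * I))) := by
  rw [← lintegral_neg_eq_self f, ← Complex.lintegral_comp_polarCoord_symm]
  change ∫⁻ p in Ioi (0 : ℝ) ×ˢ Ioo (-Real.pi) Real.pi, _ = _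
  simp only [smul_eq_mul, Complex.polarCoord_symm_apply]

lemma exists_lintegral_kernel_le {β q : ℝ} (hβ : -1 < β) (hq : β + 2 ≤ q) :
    ∃ C : ℝ, 0 < C ∧ ∀ k : ℝ, 0 < k →
      ∫⁻ z in ball (0 : ℂ) 1,
          ENNReal.ofReal ((1 + k ^ 2 * ‖1 + z‖ ^ 2) ^ (-q) * (1 - ‖z‖ ^ 2) ^ β)
        ≤ ENNReal.ofReal (C * k ^ (-(β + 2))) := by
  set J : ℝ := ∫ u in Ioi (0 : ℝ), u ^ β * (1 + u ^ 2) ^ (-(β + 1))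
  have hJ : 0 ≤ J := setIntegral_nonneg measurableSet_Ioi fun u hu => by
    have : (0 : ℝ) < u := hu
    positivity
  refine ⟨2 ^ |β| * (5 ^ (β + 2) * ((J + 1) * Real.pi)), by positivity, fun k hk => ?_⟩
  set m : ℝ := k / 5 with hm
  have hm0 : 0 < m := by positivity
  set G : ℝ → ENNReal := (Ioi (0 : ℝ)).indicator
    fun t => ENNReal.ofReal (t ^ β * (1 + (m * t) ^ 2) ^ (-(β + 1))) with hG
  set H : ℝ → ENNReal := fun θ => ENNReal.ofReal (1 + (m * θ) ^ 2)⁻¹ with hH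
  have hGm : Measurable G := Measurable.indicator (by fun_prop) measurableSet_Ioi
  have hHm : Measurable H := by fun_prop
  rw [← lintegral_indicator measurableSet_ball, lintegral_neg_polar]
  calc _ ≤ ∫⁻ x in Ioi (0 : ℝ) ×ˢ Ioo (-Real.pi) Real.pi,
          ENNReal.ofReal (2 ^ |β|) * (G (1 - x.1) * H x.2) := by
        refine setLIntegral_mono' (measurableSet_Ioi.prod measurableSet_Ioo) ?_
        rintro ⟨s, θ⟩ ⟨hs, hθ⟩
        have hs0 : 0 < s := hs
        have hnorm : ‖-((s : ℂ) * (Real.cos θ + Real.sin θ * I))‖ = s := by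
          have := Complex.norm_polarCoord_symm (s, θ)
          rw [Complex.polarCoord_symm_apply, abs_of_pos hs0] at this
          rw [norm_neg]; exact this
        dsimp only
        by_cases hs1 : s < 1
        swap
        · rw [indicator_of_notMem (by rw [mem_ball_zero_iff, hnorm]; exact hs1)]
          simp
        rw [indicator_of_mem (by rw [mem_ball_zero_iff, hnorm]; exact hs1), hG, hH,
          indicator_of_mem (by simpa using hs1), hnorm,
          ← ENNReal.ofReal_mul hs0.le, ← ENNReal.ofReal_mul (by have := sub_pos.2 hs1; positivity),
          ← ENNReal.ofReal_mul (by positivity)]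
        refine ENNReal.ofReal_le_ofReal ?_
        have ht0 : 0 < 1 - s := sub_pos.2 hs1
        have hgeom := sq_add_sq_le_norm_one_sub_polar_sq hs0.le (abs_le.2 ⟨hθ.1.le, hθ.2.le⟩)
        rw [← sub_eq_add_neg]
        set ρ := ‖1 - (s : ℂ) * (Real.cos θ + Real.sin θ * I)‖
        have hker : (1 + k ^ 2 * ρ ^ 2) ^ (-q)
            ≤ (1 + (m * (1 - s)) ^ 2) ^ (-(β + 1)) * (1 + (m * θ) ^ 2)⁻¹ := by
          refine le_trans ?_ (rpow_neg_one_add_add_le (by positivity) (by positivity) hβ hq)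
          refine Real.rpow_le_rpow_of_nonpos (by positivity) ?_ (by linarith)
          have := mul_le_mul_of_nonneg_left hgeom (sq_nonneg m)
          rw [hm] at this ⊢
          linarith
        have hweight : (1 - s ^ 2) ^ β ≤ 2 ^ |β| * (1 - s) ^ β := by
          rw [show 1 - s ^ 2 = (1 + s) * (1 - s) by ring,
            Real.mul_rpow (by positivity) ht0.le]
          gcongr
          calc (1 + s) ^ β ≤ (1 + s) ^ |β| :=
                Real.rpow_le_rpow_of_exponent_le (by linarith) (le_abs_self β)
            _ ≤ 2 ^ |β| := by gcongr; linarith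
        have hw0 : 0 ≤ (1 - s ^ 2) ^ β := Real.rpow_nonneg (by nlinarith) _
        calc s * ((1 + k ^ 2 * ρ ^ 2) ^ (-q) * (1 - s ^ 2) ^ β)
            ≤ 1 * (((1 + (m * (1 - s)) ^ 2) ^ (-(β + 1)) * (1 + (m * θ) ^ 2)⁻¹)
              * (2 ^ |β| * (1 - s) ^ β)) := by gcongr
          _ = _ := by ring
    _ ≤ ∫⁻ x : ℝ × ℝ, ENNReal.ofReal (2 ^ |β|) * (G (1 - x.1) * H x.2) :=
        setLIntegral_le_lintegral _ _
    _ = ENNReal.ofReal (2 ^ |β|) * ((∫⁻ s, G (1 - s)) * ∫⁻ θ, H θ) := by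
        rw [lintegral_const_mul' _ _ ENNReal.ofReal_ne_top, Measure.volume_eq_prod,
          lintegral_prod_mul (f := fun s => G (1 - s)) (by fun_prop) (by fun_prop)]
    _ = ENNReal.ofReal (2 ^ |β| * ((m ^ (-(β + 1)) * J) * (m⁻¹ * Real.pi))) := by
        rw [lintegral_sub_left_eq_self G, hG, lintegral_indicator measurableSet_Ioi,
          lintegral_Ioi_rpow_mul_one_add_sq_rpow hβ hm0, lintegral_inv_one_add_sq_mul hm0,
          ← ENNReal.ofReal_mul (by positivity), ← ENNReal.ofReal_mul (by positivity)]
    _ ≤ _ := by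
        refine ENNReal.ofReal_le_ofReal ?_
        have hpow : m ^ (-(β + 1)) * m⁻¹ = 5 ^ (β + 2) * k ^ (-(β + 2)) := by
          rw [← Real.rpow_neg_one m, ← Real.rpow_add hm0, hm, Real.div_rpow hk.le (by norm_num),
            show -(β + 1) + -1 = -(β + 2) by ring, Real.rpow_neg (x := 5) (by norm_num),
            div_inv_eq_mul, mul_comm]
        calc 2 ^ |β| * ((m ^ (-(β + 1)) * J) * (m⁻¹ * Real.pi))
            = 2 ^ |β| * ((m ^ (-(β + 1)) * m⁻¹) * (J * Real.pi)) := by ring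
          _ ≤ 2 ^ |β| * ((5 ^ (β + 2) * k ^ (-(β + 2))) * ((J + 1) * Real.pi)) := by
              rw [hpow]; gcongr; linarith
          _ = _ := by ring

lemma norm_add_le_norm_one_add_mul {r : ℝ} (hr0 : 0 ≤ r) (hr1 : r < 1) {z : ℂ} (hz : ‖z‖ < 1) :
    ‖(r : ℂ) + z‖ ≤ ‖1 + (r : ℂ) * z‖ := by
  refine le_of_abs_le (abs_le_of_sq_le_sq ?_ (norm_nonneg _))
  have hz2 : ‖z‖ ^ 2 < 1 := by nlinarith [norm_nonneg z]
  rw [← Complex.normSq_eq_norm_sq, Complex.normSq_apply] at hz2 ⊢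
  rw [← Complex.normSq_eq_norm_sq, Complex.normSq_apply]
  simp only [add_re, add_im, one_re, one_im, re_ofReal_mul, im_ofReal_mul, ofReal_re, ofReal_im]
  nlinarith [mul_nonneg (show 0 ≤ 1 - r ^ 2 by nlinarith)
    (show 0 ≤ 1 - (z.re * z.re + z.im * z.im) by linarith)]

lemma norm_Qfun_le {r : ℝ} (hr0 : 0 ≤ r) (hr1 : r < 1) {n : ℕ} (hn : 1 ≤ n) {z : ℂ}
    (hz : ‖z‖ < 1) :
    ‖Qfun n r z‖ ≤ 6 * n ^ 2 / (1 - r) * (1 + (n / (1 - r)) ^ 2 * ‖1 + z‖ ^ 2)⁻¹ := by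
  have hd : 0 < 1 - r := sub_pos.2 hr1
  have hn0 : (0 : ℝ) < n := by exact_mod_cast hn
  set A : ℝ := ‖1 + (r : ℂ) * z‖ with hA
  set ρ : ℝ := ‖1 + z‖ with hρ
  have hdA : 1 - r ≤ A := by
    have h1 : ‖(r : ℂ) * z‖ ≤ r := by
      rw [norm_mul, Complex.norm_of_nonneg hr0]
      exact mul_le_of_le_one_right hr0 hz.le
    have h2 := norm_sub_le_norm_add (1 : ℂ) ((r : ℂ) * z)
    rw [norm_one] at h2
    linarith
  have hA0 : 0 < A := hd.trans_le hdA
  have hne : 1 + (r : ℂ) * z ≠ 0 := norm_pos_iff.1 hA0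
  set w : ℂ := blaschkeF (-(r : ℂ)) z with hw
  have hw' : w = -((r : ℂ) + z) / (1 + (r : ℂ) * z) := by
    rw [hw, blaschkeF]
    simp only [map_neg, conj_ofReal]
    congr 1 <;> ring
  have hw1 : ‖w‖ ≤ 1 := by
    rw [hw', norm_div, norm_neg]
    exact div_le_one_of_le₀ (norm_add_le_norm_one_add_mul hr0 hr1 hz) hA0.le
  set S : ℂ := ∑ k ∈ Finset.range n, w ^ k with hS
  have hSn : ‖S‖ ≤ n := by
    calc ‖S‖ ≤ ∑ k ∈ Finset.range n, (1 : ℝ) := norm_sum_le_of_le _ fun k _ => by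
          rw [norm_pow]; exact pow_le_one₀ (norm_nonneg _) hw1
      _ = n := by simp
  have hSw : ‖S‖ * ((1 + r) * ρ) ≤ 2 * A := by
    have hsub : (1 - w) * (1 + (r : ℂ) * z) = ((1 + r : ℝ) : ℂ) * (1 + z) := by
      rw [hw']; field_simp; push_cast; ring
    have hgs : S * (1 - w) = 1 - w ^ n := geom_sum_mul_neg w n
    calc ‖S‖ * ((1 + r) * ρ) = ‖1 - w ^ n‖ * A := by
          rw [← hgs, norm_mul, mul_assoc, hA, ← norm_mul (1 - w), hsub, norm_mul,
            Complex.norm_of_nonneg (by positivity)]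
      _ ≤ 2 * A := by
          gcongr
          refine (norm_sub_le _ _).trans ?_
          rw [norm_one, norm_pow]
          linarith [pow_le_one₀ (n := n) (norm_nonneg w) hw1]
  have hSρ : (1 + r) * (‖S‖ * ρ) ^ 2 ≤ 4 * A ^ 2 := by
    calc (1 + r) * (‖S‖ * ρ) ^ 2 ≤ (1 + r) ^ 2 * (‖S‖ * ρ) ^ 2 := by gcongr; nlinarith
      _ = (‖S‖ * ((1 + r) * ρ)) ^ 2 := by ring
      _ ≤ (2 * A) ^ 2 := by gcongr
      _ = 4 * A ^ 2 := by ring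
  have hQ : ‖Qfun n r z‖ = (1 - r) * (1 + r) / A ^ 2 * ‖S‖ ^ 2 := by
    have h1 : (1 - (r : ℂ) ^ 2) = (((1 - r) * (1 + r) : ℝ) : ℂ) := by push_cast; ring
    rw [Qfun, norm_mul, norm_div, norm_pow, norm_pow, h1,
      Complex.norm_of_nonneg (by positivity)]
  rw [hQ, ← div_eq_mul_inv, le_div_iff₀ (by positivity)]
  have hfirst : (1 - r) * (1 + r) / A ^ 2 * ‖S‖ ^ 2 ≤ 2 * n ^ 2 / (1 - r) := by
    calc (1 - r) * (1 + r) / A ^ 2 * ‖S‖ ^ 2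
        ≤ (1 - r) * 2 / (1 - r) ^ 2 * (n : ℝ) ^ 2 := by gcongr; linarith
      _ = 2 * n ^ 2 / (1 - r) := by field_simp
  have hsecond : (1 - r) * (1 + r) / A ^ 2 * ‖S‖ ^ 2 * ((n / (1 - r)) ^ 2 * ρ ^ 2)
      ≤ 4 * n ^ 2 / (1 - r) := by
    calc _ = ((1 + r) * (‖S‖ * ρ) ^ 2) / A ^ 2 * (n ^ 2 / (1 - r)) := by field_simp
      _ ≤ (4 * A ^ 2) / A ^ 2 * (n ^ 2 / (1 - r)) := by gcongr
      _ = 4 * n ^ 2 / (1 - r) := by field_simp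
  calc _ = (1 - r) * (1 + r) / A ^ 2 * ‖S‖ ^ 2
        + (1 - r) * (1 + r) / A ^ 2 * ‖S‖ ^ 2 * ((n / (1 - r)) ^ 2 * ρ ^ 2) := by ring
    _ ≤ 2 * n ^ 2 / (1 - r) + 4 * n ^ 2 / (1 - r) := add_le_add hfirst hsecond
    _ = _ := by ring

end

/-- Estimate (6.4): for `β ∈ (l-1, l]`, `p ∈ [1, ∞)` and `N = l+2`,
`‖Q_n^N‖_{A^p(β)} ≤ C n^{2N-(β+2)/p} / (1-r)^{N-(β+2)/p}` with `C = C(p, β)`. -/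
theorem Qfun_pow_bergman_estimate (l : ℕ) (β : ℝ) (hβ1 : (l : ℝ) - 1 < β)
    (hβ2 : β ≤ (l : ℝ)) (p : ℝ) (hp : 1 ≤ p) :
    ∃ C : ℝ, 0 < C ∧
      ∀ r : ℝ, 0 ≤ r → r < 1 → ∀ n : ℕ, 1 ≤ n →
        bergmanNorm p β (fun z => Qfun n r z ^ (l + 2))
          ≤ C * (n : ℝ) ^ (2 * ((l : ℝ) + 2) - (β + 2) / p) /
              (1 - r) ^ (((l : ℝ) + 2) - (β + 2) / p) := by
  have hβ : -1 < β := by have : (0 : ℝ) ≤ l := l.cast_nonneg; linarith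
  have hp0 : 0 < p := by linarith
  set q : ℝ := ((l : ℝ) + 2) * p with hq
  have hq0 : 0 < q := by positivity
  obtain ⟨C, hC, hCk⟩ := exists_lintegral_kernel_le (β := β) (q := q) hβ
    (by nlinarith)
  refine ⟨(Real.pi⁻¹ * (6 ^ q * C)) ^ (1 / p), by positivity, fun r hr0 hr1 n hn => ?_⟩
  have hd : 0 < 1 - r := sub_pos.2 hr1
  have hn0 : (0 : ℝ) < n := by exact_mod_cast hn
  set k : ℝ := n / (1 - r) with hk
  have hk0 : 0 < k := by positivity
  set M : ℝ := 6 * n ^ 2 / (1 - r) with hM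
  have hM0 : 0 < M := by positivity
  have hintegral : ∫ z in ball (0 : ℂ) 1, ‖Qfun n r z ^ (l + 2)‖ ^ p * (1 - ‖z‖ ^ 2) ^ β
      ≤ M ^ q * (C * k ^ (-(β + 2))) := by
    refine (le_abs_self _).trans ?_
    rw [← Real.norm_eq_abs]
    refine (MeasureTheory.norm_integral_le_lintegral_norm _).trans ?_
    refine ENNReal.toReal_le_of_le_ofReal (by positivity) ?_
    rw [ENNReal.ofReal_mul (by positivity)]
    refine le_trans ?_ (mul_le_mul_right (hCk k hk0) _)
    rw [← MeasureTheory.lintegral_const_mul' _ _ ENNReal.ofReal_ne_top]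
    refine MeasureTheory.setLIntegral_mono' measurableSet_ball fun z hz => ?_
    rw [← ENNReal.ofReal_mul (by positivity)]
    refine ENNReal.ofReal_le_ofReal ?_
    have hz1 : ‖z‖ < 1 := mem_ball_zero_iff.1 hz
    have hw : 0 ≤ (1 - ‖z‖ ^ 2) ^ β := Real.rpow_nonneg (by nlinarith [norm_nonneg z]) _
    rw [Real.norm_of_nonneg (by positivity), ← mul_assoc]
    gcongr
    calc ‖Qfun n r z ^ (l + 2)‖ ^ p = ‖Qfun n r z‖ ^ q := by
          rw [norm_pow, ← Real.rpow_natCast, ← Real.rpow_mul (norm_nonneg _)]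
          push_cast; rfl
      _ ≤ (M * (1 + k ^ 2 * ‖1 + z‖ ^ 2)⁻¹) ^ q := by
          gcongr
          exact norm_Qfun_le hr0 hr1 hn hz1
      _ = M ^ q * (1 + k ^ 2 * ‖1 + z‖ ^ 2) ^ (-q) := by
          rw [Real.mul_rpow hM0.le (by positivity), Real.inv_rpow (by positivity),
            Real.rpow_neg (by positivity)]
  have hMq : M ^ q = 6 ^ q * ((n : ℝ) ^ (2 * q) / (1 - r) ^ q) := by
    rw [hM, mul_div_assoc, Real.mul_rpow (by norm_num) (by positivity),
      Real.div_rpow (by positivity) hd.le, ← Real.rpow_natCast, ← Real.rpow_mul hn0.le]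
    norm_cast
  have hkβ : k ^ (-(β + 2)) = (n : ℝ) ^ (-(β + 2)) / (1 - r) ^ (-(β + 2)) :=
    Real.div_rpow hn0.le hd.le _
  have hfactor : Real.pi⁻¹ * (M ^ q * (C * k ^ (-(β + 2)))) = (Real.pi⁻¹ * (6 ^ q * C)) *
      ((n : ℝ) ^ (2 * q - (β + 2)) / (1 - r) ^ (q - (β + 2))) := by
    rw [hMq, hkβ, sub_eq_add_neg _ (β + 2), sub_eq_add_neg _ (β + 2), Real.rpow_add hn0, Real.rpow_add hd]
    field_simp
  calc bergmanNorm p β (fun z => Qfun n r z ^ (l + 2))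
      ≤ (Real.pi⁻¹ * (M ^ q * (C * k ^ (-(β + 2))))) ^ (1 / p) := by
        unfold bergmanNorm
        have hnn : 0 ≤ ∫ z in ball (0 : ℂ) 1, ‖Qfun n r z ^ (l + 2)‖ ^ p * (1 - ‖z‖ ^ 2) ^ β :=
          MeasureTheory.setIntegral_nonneg measurableSet_ball fun z hz => by
            have hz1 : ‖z‖ < 1 := mem_ball_zero_iff.1 hz
            have : 0 ≤ 1 - ‖z‖ ^ 2 := by nlinarith [norm_nonneg z]
            positivity
        gcongr
    _ = _ := by
        rw [hfactor, Real.mul_rpow (by positivity) (by positivity),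
          Real.div_rpow (by positivity) (by positivity), ← Real.rpow_mul hn0.le,
          ← Real.rpow_mul hd.le, mul_div_assoc]
        have h1 : (2 * q - (β + 2)) * (1 / p) = 2 * ((l : ℝ) + 2) - (β + 2) / p := by
          rw [hq]; field_simp
        have h2 : (q - (β + 2)) * (1 / p) = ((l : ℝ) + 2) - (β + 2) / p := by
          rw [hq]; field_simp
        rw [h1, h2]
end
end
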